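/- The equation 2√e·log x + x = 0 has a unique positive root t̄, and under the stated limit assumptions the product r_∞·u_∞ equals this root, i.e. 2√e·log(r_∞·u_∞) + r_∞·u_∞ = 0; consequently r_∞ = t̄/u_∞. -/

import Mathlib

open Real MeasureTheory Set Filter

noncomputable section

/-- The radial energy functional for the Lane–Emden problem on the unit ball of `ℝ²`
(written in polar coordinates; the common factor `2π` is dropped). -/
def radialEnergy (p : ℝ) (v : ℝ → ℝ) : ℝ :=
  (1 / 2) * (∫ r in (0:ℝ)..1, (deriv v r) ^ 2 * r)
    - (1 / (p + 1)) * ∫ r in (0:ℝ)..1, |v r| ^ (p + 1) * r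

/-- The Nehari identity `∫_B |∇v⁺|² = ∫_B |v⁺|^{p+1}` for the positive part,
written in polar coordinates. -/
def nehariPos (p : ℝ) (v : ℝ → ℝ) : Prop :=
  (∫ r in (0:ℝ)..1, (if 0 < v r then (deriv v r) ^ 2 * r else 0))
    = ∫ r in (0:ℝ)..1, (max (v r) 0) ^ (p + 1) * r

/-- The Nehari identity `∫_B |∇v⁻|² = ∫_B |v⁻|^{p+1}` for the negative part,
written in polar coordinates. -/
def nehariNeg (p : ℝ) (v : ℝ → ℝ) : Prop :=
  (∫ r in (0:ℝ)..1, (if v r < 0 then (deriv v r) ^ 2 * r else 0))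
    = ∫ r in (0:ℝ)..1, (max (-v r) 0) ^ (p + 1) * r

/-- A family `p ↦ u p` (for `p > 1`) of least energy nodal radial solutions of the
Lane–Emden problem `−Δu = |u|^{p−1}u` in the unit ball `B ⊆ ℝ²`, `u = 0` on `∂B`,
described through the radial profile `u p : ℝ → ℝ`.  `rp p ∈ (0,1)` is the nodal
radius, `sp p ∈ (rp p, 1)` is a radius where `u p` attains `‖(u p)⁺‖_∞`; the solution
is negative in the inner nodal region (`u p 0 < 0`), attains `-‖(u p)⁻‖_∞` at `0`,
and minimizes the energy among radial members of the nodal Nehari set. -/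
structure LaneEmdenFamily where
  u : ℝ → ℝ → ℝ
  rp : ℝ → ℝ
  sp : ℝ → ℝ
  smooth : ∀ p, 1 < p → ContDiffOn ℝ 2 (u p) (Icc (0:ℝ) 1)
  ode : ∀ p, 1 < p → ∀ r ∈ Ioo (0:ℝ) 1,
    -deriv (deriv (u p)) r - deriv (u p) r / r = |u p r| ^ (p - 1) * u p r
  derivAtZero : ∀ p, 1 < p → deriv (u p) 0 = 0
  boundary : ∀ p, 1 < p → u p 1 = 0
  center_neg : ∀ p, 1 < p → u p 0 < 0
  min_at_zero : ∀ p, 1 < p → ∀ r ∈ Icc (0:ℝ) 1, u p 0 ≤ u p r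
  rp_mem : ∀ p, 1 < p → rp p ∈ Ioo (0:ℝ) 1
  rp_zero : ∀ p, 1 < p → u p (rp p) = 0
  neg_in : ∀ p, 1 < p → ∀ r ∈ Ico (0:ℝ) (rp p), u p r < 0
  pos_out : ∀ p, 1 < p → ∀ r ∈ Ioo (rp p) 1, 0 < u p r
  sp_mem : ∀ p, 1 < p → sp p ∈ Ioo (rp p) 1
  sp_max : ∀ p, 1 < p → ∀ r ∈ Icc (0:ℝ) 1, u p r ≤ u p (sp p)
  least_energy : ∀ p, 1 < p → ∀ v : ℝ → ℝ,
    ContDiffOn ℝ 1 v (Icc (0:ℝ) 1) → v 1 = 0 →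
    (∃ r ∈ Ioo (0:ℝ) 1, 0 < v r) → (∃ r ∈ Ioo (0:ℝ) 1, v r < 0) →
    nehariPos p v → nehariNeg p v →
    radialEnergy p (u p) ≤ radialEnergy p v

/-- `ε_p⁺`, defined by `(ε_p⁺)⁻² = p · ‖u_p⁺‖_∞^{p−1} = p · u_p(s_p)^{p−1}`. -/
def epsP (F : LaneEmdenFamily) (p : ℝ) : ℝ :=
  1 / Real.sqrt (p * F.u p (F.sp p) ^ (p - 1))

/-- `ε_p⁻`, defined by `(ε_p⁻)⁻² = p · ‖u_p⁻‖_∞^{p−1} = p · |u_p(0)|^{p−1}`. -/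
def epsM (F : LaneEmdenFamily) (p : ℝ) : ℝ :=
  1 / Real.sqrt (p * (-F.u p 0) ^ (p - 1))

/-- `α = √(2l² + 4)`. -/
def alphaOf (l : ℝ) : ℝ := Real.sqrt (2 * l ^ 2 + 4)

/-- `β = ((α+2)/(α−2))^{1/α} · l`. -/
def betaOf (l : ℝ) : ℝ := ((alphaOf l + 2) / (alphaOf l - 2)) ^ (1 / alphaOf l) * l

/-- The singular Liouville profile `Z_l(r) = log(2α²β^α r^{α−2}/(β^α + r^α)²)`. -/
def Zl (l : ℝ) (r : ℝ) : ℝ :=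
  Real.log (2 * alphaOf l ^ 2 * betaOf l ^ alphaOf l * r ^ (alphaOf l - 2)
    / (betaOf l ^ alphaOf l + r ^ alphaOf l) ^ 2)

theorem le_of_hasDerivAt_nonneg {f f' : ℝ → ℝ} {a b : ℝ} (hab : a ≤ b)
    (hc : ContinuousOn f (Icc a b)) (hd : ∀ x ∈ Ioo a b, HasDerivAt f (f' x) x)
    (hn : ∀ x ∈ Ioo a b, 0 ≤ f' x) : f a ≤ f b := by
  refine monotoneOn_of_deriv_nonneg (convex_Icc a b) hc ?_ ?_ (left_mem_Icc.2 hab)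
    (right_mem_Icc.2 hab) hab
  · rw [interior_Icc]
    exact fun x hx => (hd x hx).differentiableAt.differentiableWithinAt
  · rw [interior_Icc]
    exact fun x hx => (hd x hx).deriv ▸ hn x hx

theorem le_of_hasDerivAt_nonpos {f f' : ℝ → ℝ} {a b : ℝ} (hab : a ≤ b)
    (hc : ContinuousOn f (Icc a b)) (hd : ∀ x ∈ Ioo a b, HasDerivAt f (f' x) x)
    (hn : ∀ x ∈ Ioo a b, f' x ≤ 0) : f b ≤ f a :=
  neg_le_neg_iff.1 <| le_of_hasDerivAt_nonneg (f := fun x => -f x) (f' := fun x => -f' x) hab hc.neg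
    (fun x hx => (hd x hx).neg) (fun x hx => neg_nonneg.2 (hn x hx))

/-- A normalized positive radial solution `f` of the planar Lane–Emden equation
`-Δf = (μ / p) f ^ p` on the disc of radius `R`, together with its flux `Y(r) = -p r f'(r)`. -/
structure LaneEmdenProfile (p μ R : ℝ) (f Y : ℝ → ℝ) : Prop where
  p_pos : 0 < p
  μ_pos : 0 < μ
  R_pos : 0 < R
  f_cont : ContinuousOn f (Icc 0 R)
  Y_cont : ContinuousOn Y (Icc 0 R)
  f_zero : f 0 = 1
  f_R : f R = 0
  Y_zero : Y 0 = 0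
  f_pos : ∀ r ∈ Ioo 0 R, 0 < f r
  f_le : ∀ r ∈ Ioo 0 R, f r ≤ 1
  f_deriv : ∀ r ∈ Ioo 0 R, HasDerivAt f (-Y r / (p * r)) r
  Y_deriv : ∀ r ∈ Ioo 0 R, HasDerivAt Y (μ * r * f r ^ p) r

namespace LaneEmdenProfile

variable {p μ R : ℝ} {f Y : ℝ → ℝ}

theorem Y_mono (h : LaneEmdenProfile p μ R f Y) {s r : ℝ} (hs : 0 ≤ s) (hsr : s ≤ r)
    (hr : r ≤ R) : Y s ≤ Y r := by
  refine le_of_hasDerivAt_nonneg hsr (h.Y_cont.mono (Icc_subset_Icc hs hr))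
    (fun x hx => h.Y_deriv x ⟨hs.trans_lt hx.1, hx.2.trans_le hr⟩) (fun x hx => ?_)
  have hx' : x ∈ Ioo 0 R := ⟨hs.trans_lt hx.1, hx.2.trans_le hr⟩
  have := h.μ_pos
  have := hx'.1
  have := h.f_pos x hx'
  positivity

theorem Y_nonneg (h : LaneEmdenProfile p μ R f Y) {r : ℝ} (hr0 : 0 ≤ r) (hr : r ≤ R) :
    0 ≤ Y r := by
  simpa [h.Y_zero] using h.Y_mono le_rfl hr0 hr

theorem Y_le_sq (h : LaneEmdenProfile p μ R f Y) {r : ℝ} (hr0 : 0 ≤ r) (hr : r ≤ R) :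
    Y r ≤ μ / 2 * r ^ 2 := by
  have key : Y r - μ / 2 * r ^ 2 ≤ Y 0 - μ / 2 * 0 ^ 2 := by
    refine le_of_hasDerivAt_nonpos (f := fun x => Y x - μ / 2 * x ^ 2)
      (f' := fun x => μ * x * f x ^ p - μ / 2 * (2 * x)) hr0
      ((h.Y_cont.mono (Icc_subset_Icc le_rfl hr)).sub (by fun_prop)) (fun x hx => ?_)
      (fun x hx => ?_)
    · have hx' : x ∈ Ioo 0 R := ⟨hx.1, hx.2.trans_le hr⟩
      exact (h.Y_deriv x hx').sub
        (by simpa using (hasDerivAt_pow 2 x).const_mul (μ / 2))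
    · have hx' : x ∈ Ioo 0 R := ⟨hx.1, hx.2.trans_le hr⟩
      have h1 := rpow_le_one (h.f_pos x hx').le (h.f_le x hx') h.p_pos.le
      have h2 : 0 < μ * x := mul_pos h.μ_pos hx.1
      nlinarith
  rw [h.Y_zero] at key
  linarith

/-- The Pohozaev inequality. -/
theorem pohozaev (h : LaneEmdenProfile p μ R f Y) {r : ℝ} (hr0 : 0 < r) (hr : r < R) :
    μ * r ^ 2 * f r ^ p ≤ 2 * Y r - Y r ^ 2 / 2 := by
  have hsub : Icc 0 r ⊆ Icc 0 R := Icc_subset_Icc le_rfl hr.le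
  have hf := h.f_cont.mono hsub
  have hY := h.Y_cont.mono hsub
  have key : μ * r ^ 2 * f r ^ p - 2 * Y r + Y r ^ 2 / 2
      ≤ μ * 0 ^ 2 * f 0 ^ p - 2 * Y 0 + Y 0 ^ 2 / 2 := by
    refine le_of_hasDerivAt_nonpos (f := fun x => μ * x ^ 2 * f x ^ p - 2 * Y x + Y x ^ 2 / 2)
      (f' := fun x => Y x * (μ * x * f x ^ (p - 1)) * (f x - 1)) hr0.le ?_ (fun x hx => ?_)
      (fun x hx => ?_)
    · have := hf.rpow_const (p := p) (fun x _ => Or.inr h.p_pos.le)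
      fun_prop
    · have hx' : x ∈ Ioo 0 R := ⟨hx.1, hx.2.trans hr⟩
      have hfx := h.f_pos x hx'
      have hx0 : x ≠ 0 := hx.1.ne'
      have hp0 := h.p_pos.ne'
      have hpow : f x ^ p = f x ^ (p - 1) * f x := by
        rw [← rpow_add_one hfx.ne']; ring_nf
      have h1 := ((hasDerivAt_pow 2 x).const_mul μ).mul
        ((h.f_deriv x hx').rpow_const (p := p) (Or.inl hfx.ne'))
      have h2 := (h.Y_deriv x hx').const_mul 2
      have h3 := ((h.Y_deriv x hx').pow 2).div_const 2
      refine HasDerivAt.congr_deriv ((h1.sub h2).add h3) ?_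
      simp only [hpow, Nat.cast_ofNat, Nat.add_one_sub_one, pow_one]
      field_simp
      ring
    · have hx' : x ∈ Ioo 0 R := ⟨hx.1, hx.2.trans hr⟩
      have hfx := h.f_pos x hx'
      have := h.μ_pos
      have := hx.1
      have hYx := h.Y_nonneg hx'.1.le hx'.2.le
      exact mul_nonpos_of_nonneg_of_nonpos (by positivity) (by linarith [h.f_le x hx'])
  rw [h.Y_zero] at key
  norm_num at key
  linarith

theorem Y_bounds (h : LaneEmdenProfile p μ R f Y) {r : ℝ} (hr0 : 0 < r) (hr : r < R) :
    0 < Y r ∧ Y r < 4 := by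
  have h1 := h.pohozaev hr0 hr
  have h2 : 0 < μ * r ^ 2 * f r ^ p := by
    have := h.μ_pos
    have := h.f_pos r ⟨hr0, hr⟩
    positivity
  have h3 := h.Y_nonneg hr0.le hr.le
  constructor <;> nlinarith

theorem Y_R_le (h : LaneEmdenProfile p μ R f Y) : Y R ≤ 4 := by
  have hmem : Ioo 0 R ∈ nhdsWithin R (Iio R) := Ioo_mem_nhdsLT h.R_pos
  have ht : Tendsto Y (nhdsWithin R (Iio R)) (nhds (Y R)) :=
    ((h.Y_cont R (right_mem_Icc.2 h.R_pos.le)).mono_of_mem_nhdsWithin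
      (mem_of_superset hmem Ioo_subset_Icc_self))
  exact le_of_tendsto ht (mem_of_superset hmem fun r hr => (h.Y_bounds hr.1 hr.2).2.le)

/-- Comparison of the flux with that of the Liouville bubble. -/
theorem Y_le_bubble (h : LaneEmdenProfile p μ R f Y) {r : ℝ} (hr0 : 0 < r) (hr : r < R) :
    Y r * (1 + μ * r ^ 2 / 8) ≤ μ * r ^ 2 / 2 := by
  have hmono : ∀ s ∈ Ioo 0 r, Y r / ((4 - Y r) * r ^ 2) ≤ μ / 2 / (4 - Y s) := by
    intro s hs
    have hsR := hs.2.trans hr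
    have hs4 := (h.Y_bounds hs.1 hsR).2
    have step1 : Y r / ((4 - Y r) * r ^ 2) ≤ Y s / ((4 - Y s) * s ^ 2) := by
      have hx' : ∀ x ∈ Icc s r, 0 < x ∧ x < R := fun x hx =>
        ⟨hs.1.trans_le hx.1, hx.2.trans_lt hr⟩
      refine le_of_hasDerivAt_nonpos (f := fun x => Y x / ((4 - Y x) * x ^ 2))
        (f' := fun x => ((μ * x * f x ^ p) * ((4 - Y x) * x ^ 2) - Y x * (-(μ * x * f x ^ p) * x ^ 2
          + (4 - Y x) * (2 * x))) / ((4 - Y x) * x ^ 2) ^ 2) hs.2.le ?_ (fun x hx => ?_)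
        (fun x hx => ?_)
      · have hY := h.Y_cont.mono (Icc_subset_Icc hs.1.le hr.le)
        refine hY.div (by fun_prop) fun x hx => ?_
        have h1 := hx' x hx
        have h2 := (h.Y_bounds h1.1 h1.2).2
        exact mul_ne_zero (by linarith) (pow_ne_zero _ h1.1.ne')
      · have h1 := hx' x (Ioo_subset_Icc_self hx)
        have h2 := (h.Y_bounds h1.1 h1.2).2
        have hY := h.Y_deriv x h1
        refine hY.div ((hY.const_sub 4).mul ?_)
          (mul_ne_zero (by linarith) (pow_ne_zero _ h1.1.ne'))
        simpa using hasDerivAt_pow 2 x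
      · have h1 := hx' x (Ioo_subset_Icc_self hx)
        have h3 := h.pohozaev h1.1 h1.2
        refine div_nonpos_of_nonpos_of_nonneg ?_ (sq_nonneg _)
        have : 0 ≤ 4 * x * (2 * Y x - Y x ^ 2 / 2 - μ * x ^ 2 * f x ^ p) :=
          mul_nonneg (by linarith [h1.1]) (by linarith)
        linarith
    refine step1.trans ?_
    have hs2 : 0 < s ^ 2 := pow_pos hs.1 2
    have h4 : 0 < 4 - Y s := by linarith
    rw [div_le_div_iff₀ (by positivity) h4]
    have := h.Y_le_sq hs.1.le hsR.le
    nlinarith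
  have hmem : Ioo 0 r ∈ nhdsWithin 0 (Ioi (0 : ℝ)) := Ioo_mem_nhdsGT hr0
  have hY0 : Tendsto Y (nhdsWithin 0 (Ioi 0)) (nhds 0) := by
    have := (h.Y_cont 0 (left_mem_Icc.2 h.R_pos.le)).mono_of_mem_nhdsWithin
      (mem_of_superset (Ioo_mem_nhdsGT h.R_pos) Ioo_subset_Icc_self)
    simpa [ContinuousWithinAt, h.Y_zero] using this
  have hlim : Tendsto (fun s => μ / 2 / (4 - Y s)) (nhdsWithin 0 (Ioi 0))
      (nhds (μ / 2 / (4 - 0))) :=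
    tendsto_const_nhds.div (tendsto_const_nhds.sub hY0) (by norm_num)
  have hfin := ge_of_tendsto hlim (mem_of_superset hmem hmono)
  have h4 := (h.Y_bounds hr0 hr).2
  rw [div_le_iff₀ (by have : 0 < 4 - Y r := by linarith
                      positivity)] at hfin
  nlinarith

theorem f_lower (h : LaneEmdenProfile p μ R f Y) {r : ℝ} (hr0 : 0 ≤ r) (hr : r ≤ R) :
    1 ≤ f r + 2 / p * log (1 + μ * r ^ 2 / 8) := by
  have hpos : ∀ x : ℝ, 0 < 1 + μ * x ^ 2 / 8 := fun x => by
    have := h.μ_pos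
    positivity
  have key : f 0 + 2 / p * log (1 + μ * 0 ^ 2 / 8) ≤ f r + 2 / p * log (1 + μ * r ^ 2 / 8) := by
    refine le_of_hasDerivAt_nonneg (f := fun x => f x + 2 / p * log (1 + μ * x ^ 2 / 8))
      (f' := fun x => -Y x / (p * x) + 2 / p * ((μ * (2 * x) / 8) / (1 + μ * x ^ 2 / 8)))
      hr0 ?_ (fun x hx => ?_) (fun x hx => ?_)
    · have hf := h.f_cont.mono (Icc_subset_Icc le_rfl hr)
      have : Continuous fun x => log (1 + μ * x ^ 2 / 8) :=
        Continuous.log (by fun_prop) fun x => (hpos x).ne'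
      exact hf.add (continuous_const.mul this).continuousOn
    · have hx' : x ∈ Ioo 0 R := ⟨hx.1, hx.2.trans_le hr⟩
      have h1 : HasDerivAt (fun x : ℝ => 1 + μ * x ^ 2 / 8) (μ * (2 * x) / 8) x := by
        simpa using (((hasDerivAt_pow 2 x).const_mul μ).div_const 8).const_add 1
      exact (h.f_deriv x hx').add ((h1.log (hpos x).ne').const_mul (2 / p))
    · have hx' : x ∈ Ioo 0 R := ⟨hx.1, hx.2.trans_le hr⟩
      have h1 := h.Y_le_bubble hx'.1 hx'.2
      have hp := h.p_pos
      have hx0 := hx.1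
      have hd := hpos x
      have : -Y x / (p * x) + 2 / p * ((μ * (2 * x) / 8) / (1 + μ * x ^ 2 / 8))
          = (μ * x ^ 2 / 2 - Y x * (1 + μ * x ^ 2 / 8)) / (p * x * (1 + μ * x ^ 2 / 8)) := by
        have := hd.ne'
        generalize 1 + μ * x ^ 2 / 8 = d at this
        field_simp
        ring
      rw [this]
      exact div_nonneg (by linarith) (by positivity)
  simpa [h.f_zero] using key

theorem exp_le (h : LaneEmdenProfile p μ R f Y) : exp (p / 2) ≤ 1 + μ * R ^ 2 / 8 := by
  have h1 := h.f_lower h.R_pos.le le_rfl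
  have hpos : 0 < 1 + μ * R ^ 2 / 8 := by
    have := h.μ_pos
    positivity
  rw [h.f_R, zero_add, div_mul_eq_mul_div, le_div_iff₀ h.p_pos] at h1
  rw [← le_log_iff_exp_le hpos]
  linarith

theorem Y_lower (h : LaneEmdenProfile p μ R f Y) {r L : ℝ} (hr0 : 0 < r) (hr : r < R)
    (hL : L = log (1 + μ * r ^ 2 / 8)) (hLp : 2 * L < p) :
    4 * (μ * r ^ 2 / 8) / (1 + μ * r ^ 2 / 8) * exp (-(2 * L * (2 * L / (p - 2 * L)))) ≤ Y r := by
  have hp := h.p_pos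
  have hμ := h.μ_pos
  have hpos : ∀ x : ℝ, 0 < 1 + μ * x ^ 2 / 8 := fun x => by positivity
  set c := exp (-(2 * L * (2 * L / (p - 2 * L))))
  have key : Y 0 - c * (4 * (μ * 0 ^ 2 / 8) / (1 + μ * 0 ^ 2 / 8))
      ≤ Y r - c * (4 * (μ * r ^ 2 / 8) / (1 + μ * r ^ 2 / 8)) := by
    refine le_of_hasDerivAt_nonneg
      (f := fun x => Y x - c * (4 * (μ * x ^ 2 / 8) / (1 + μ * x ^ 2 / 8)))
      (f' := fun x => μ * x * f x ^ p - c * (μ * x / (1 + μ * x ^ 2 / 8) ^ 2))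
      hr0.le ?_ (fun x hx => ?_) (fun x hx => ?_)
    · have hY := h.Y_cont.mono (Icc_subset_Icc le_rfl hr.le)
      have : Continuous fun x => 4 * (μ * x ^ 2 / 8) / (1 + μ * x ^ 2 / 8) :=
        Continuous.div (by fun_prop) (by fun_prop) fun x => (hpos x).ne'
      exact hY.sub (continuous_const.mul this).continuousOn
    · have hx' : x ∈ Ioo 0 R := ⟨hx.1, hx.2.trans hr⟩
      have h1 : HasDerivAt (fun x : ℝ => μ * x ^ 2 / 8) (μ * (2 * x) / 8) x := by
        simpa using ((hasDerivAt_pow 2 x).const_mul μ).div_const 8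
      have h2 := ((h1.const_mul 4).div (h1.const_add 1) (hpos x).ne').const_mul c
      refine HasDerivAt.congr_deriv ((h.Y_deriv x hx').sub h2) ?_
      ring
    · have hx' : x ∈ Ioo 0 R := ⟨hx.1, hx.2.trans hr⟩
      have hx0 := hx.1
      have hfx := h.f_pos x hx'
      set l := log (1 + μ * x ^ 2 / 8) with hl
      have hl0 : 0 ≤ l := log_nonneg (by have : 0 ≤ μ * x ^ 2 / 8 := by positivity
                                         linarith)
      have hlL : l ≤ L := by
        rw [hL]
        apply log_le_log (hpos x)
        have := hx.2.le
        gcongr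
      have hden : 0 < p - 2 * L := by linarith
      have hden' : 0 < p - 2 * l := by linarith
      have hlow : (p - 2 * l) / p ≤ f x := by
        have := h.f_lower hx'.1.le hx'.2.le
        rw [← hl] at this
        have e : (p - 2 * l) / p = 1 - 2 / p * l := by field_simp
        linarith
      have hq : 0 < (p - 2 * l) / p := by positivity
      have hlog : -(2 * L * (2 * L / (p - 2 * L))) - 2 * l ≤ p * log (f x) := by
        have h1 := one_sub_inv_le_log_of_pos hq
        have h2 := log_le_log hq hlow
        have h3 : p * (1 - ((p - 2 * l) / p)⁻¹) = -(2 * l * (2 * l / (p - 2 * l))) - 2 * l := by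
          field_simp
          ring
        have h4 : 2 * l * (2 * l / (p - 2 * l)) ≤ 2 * L * (2 * L / (p - 2 * L)) := by
          have := hl0.trans hlL
          gcongr
        have h5 : p * (1 - ((p - 2 * l) / p)⁻¹) ≤ p * log (f x) := by
          gcongr
          linarith
        linarith
      have hpw : c / (1 + μ * x ^ 2 / 8) ^ 2 ≤ f x ^ p := by
        have e2 : (1 + μ * x ^ 2 / 8) ^ 2 = exp (2 * l) := by
          rw [two_mul, exp_add, hl, exp_log (hpos x), sq]
        rw [rpow_def_of_pos hfx, e2, ← exp_sub, exp_le_exp]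
        linarith
      have : c * (μ * x / (1 + μ * x ^ 2 / 8) ^ 2) = μ * x * (c / (1 + μ * x ^ 2 / 8) ^ 2) := by
        ring
      rw [this, sub_nonneg]
      gcongr
  rw [h.Y_zero] at key
  norm_num at key
  linarith

theorem log_le (h : LaneEmdenProfile p μ R f Y) {r q : ℝ} (hr0 : 0 < r) (hr : r < R)
    (hq : 0 < q) (hqY : q ≤ Y r) : log R - log r ≤ p / q := by
  have hp := h.p_pos
  have key : f R + q / p * log R ≤ f r + q / p * log r := by
    refine le_of_hasDerivAt_nonpos (f := fun x => f x + q / p * log x)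
      (f' := fun x => -Y x / (p * x) + q / p * x⁻¹) hr.le ?_ (fun x hx => ?_) (fun x hx => ?_)
    · have hf := h.f_cont.mono (Icc_subset_Icc hr0.le le_rfl)
      have : ContinuousOn log (Icc r R) :=
        continuousOn_log.mono fun x hx => (hr0.trans_le hx.1).ne'
      fun_prop
    · exact (h.f_deriv x ⟨hr0.trans hx.1, hx.2⟩).add
        ((hasDerivAt_log (hr0.trans hx.1).ne').const_mul _)
    · have hx0 := hr0.trans hx.1
      have h1 := h.Y_mono hr0.le hx.1.le hx.2.le
      have : -Y x / (p * x) + q / p * x⁻¹ = (q - Y x) / (p * x) := by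
        field_simp
        ring
      rw [this]
      exact div_nonpos_of_nonpos_of_nonneg (by linarith) (by positivity)
  rw [h.f_R] at key
  have h1 := h.f_le r ⟨hr0, hr⟩
  have h2 : q / p * (log R - log r) ≤ 1 := by linarith
  rw [le_div_iff₀ hq]
  rw [div_mul_eq_mul_div, div_le_one hp] at h2
  linarith

end LaneEmdenProfile

theorem LaneEmdenProfile.exists_uniform_bound {q : ℝ} (hq : 0 < q) (hq4 : q < 4) :
    ∃ C : ℝ, ∀ᶠ p in atTop, ∀ (μ R : ℝ) (f Y : ℝ → ℝ), LaneEmdenProfile p μ R f Y →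
      q ≤ Y R ∧ log (μ * R ^ 2 / 8) ≤ C + 2 * p / q := by
  obtain ⟨q', hqq', hq'4⟩ := exists_between hq4
  have hq'0 := hq.trans hqq'
  have hd : 0 < 4 - q' := by linarith
  set X := q' / (4 - q') with hX
  have hX0 : 0 < X := by positivity
  set L := log (1 + X)
  have hXq : 4 * X / (1 + X) = q' := by
    rw [hX]
    field_simp
    ring
  have hlim : Tendsto (fun p : ℝ => q' * exp (-(2 * L * (2 * L / (p - 2 * L))))) atTop
      (nhds (q' * exp (-(2 * L * 0)))) := by
    have : Tendsto (fun p : ℝ => p - 2 * L) atTop atTop :=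
      tendsto_atTop_add_const_right _ _ tendsto_id
    exact (((this.const_div_atTop _).const_mul _).neg.rexp).const_mul _
  have hev := hlim.eventually (lt_mem_nhds (a := q) (by simpa using hqq'))
  refine ⟨log X, ?_⟩
  filter_upwards [hev, eventually_gt_atTop (2 * L)] with p hp1 hp2 μ R f Y h
  have hμ := h.μ_pos
  have hR := h.R_pos
  have hbig : X < μ * R ^ 2 / 8 := by
    have h1 := h.exp_le
    have h2 : 1 + X < exp (p / 2) := by
      rw [← log_lt_iff_lt_exp (by positivity)]
      linarith
    linarith
  set r := √(8 * X / μ) with hr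
  have hr0 : 0 < r := by positivity
  have hr2 : r ^ 2 = 8 * X / μ := sq_sqrt (by positivity)
  have hx : μ * r ^ 2 / 8 = X := by
    rw [hr2]
    field_simp
  have hrR : r < R := by
    refine lt_of_pow_lt_pow_left₀ 2 hR.le ?_
    have : μ * r ^ 2 < μ * R ^ 2 := by linarith
    exact lt_of_mul_lt_mul_left this hμ.le
  have hY : q ≤ Y r := by
    have := h.Y_lower (L := L) hr0 hrR (by rw [hx]) hp2
    rw [hx, hXq] at this
    linarith
  refine ⟨hY.trans (h.Y_mono hr0.le hrR.le le_rfl), ?_⟩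
  have h1 := h.log_le hr0 hrR hq hY
  have e1 : log (μ * R ^ 2 / 8) - log X = 2 * (log R - log r) := by
    rw [← hx, ← log_div (by positivity) (by positivity), ← log_div (by positivity) (by positivity)]
    have : μ * R ^ 2 / 8 / (μ * r ^ 2 / 8) = (R / r) ^ 2 := by
      field_simp
    rw [this, log_pow]
    norm_num
  have : 2 * p / q = 2 * (p / q) := by ring
  linarith

theorem LaneEmdenProfile.tendsto_flux {pn μ R : ℕ → ℝ} {f Y : ℕ → ℝ → ℝ}
    (hp : Tendsto pn atTop atTop)
    (h : ∀ n, LaneEmdenProfile (pn n) (μ n) (R n) (f n) (Y n)) :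
    Tendsto (fun n => Y n (R n)) atTop (nhds 4) := by
  refine tendsto_order.2 ⟨fun a ha => ?_, fun a ha => Eventually.of_forall fun n =>
    (h n).Y_R_le.trans_lt ha⟩
  obtain ⟨q, hq1, hq2⟩ := exists_between (max_lt ha (by norm_num : (0 : ℝ) < 4))
  obtain ⟨C, hC⟩ := exists_uniform_bound ((le_max_right _ _).trans_lt hq1) hq2
  filter_upwards [hp.eventually hC] with n hn
  exact ((le_max_left _ _).trans_lt hq1).trans_le (hn _ _ _ _ (h n)).1

theorem LaneEmdenProfile.tendsto_log_div {pn μ R : ℕ → ℝ} {f Y : ℕ → ℝ → ℝ}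
    (hp : Tendsto pn atTop atTop)
    (h : ∀ n, LaneEmdenProfile (pn n) (μ n) (R n) (f n) (Y n)) :
    Tendsto (fun n => log (μ n * R n ^ 2 / 8) / pn n) atTop (nhds (1 / 2)) := by
  refine tendsto_order.2 ⟨fun a ha => ?_, fun a ha => ?_⟩
  · have hlim : Tendsto (fun n => 1 / 2 - log 2 / pn n) atTop (nhds (1 / 2 - 0)) :=
      tendsto_const_nhds.sub (hp.const_div_atTop _)
    filter_upwards [hlim.eventually (lt_mem_nhds (a := a) (by simpa using ha)),
      hp.eventually (eventually_ge_atTop 2)] with n hn h2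
    refine hn.trans_le ?_
    have hp0 := (h n).p_pos
    have h3 := (h n).exp_le
    have h4 : 2 ≤ exp (pn n / 2) := by linarith [add_one_le_exp (pn n / 2)]
    have h5 : exp (pn n / 2) / 2 ≤ μ n * R n ^ 2 / 8 := by linarith
    have h6 := log_le_log (by positivity) h5
    rw [log_div (exp_pos _).ne' (by norm_num), log_exp] at h6
    rw [le_div_iff₀ hp0, sub_mul, div_mul_cancel₀ _ hp0.ne']
    linarith
  · have hpos : 0 < a := by linarith
    have h2a : 2 / a < 4 := by
      rw [div_lt_iff₀ hpos]
      linarith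
    obtain ⟨q, hq1, hq2⟩ := exists_between h2a
    have hq0 : 0 < q := lt_trans (by positivity) hq1
    obtain ⟨C, hC⟩ := exists_uniform_bound hq0 hq2
    have hlim : Tendsto (fun n => C / pn n + 2 / q) atTop (nhds (0 + 2 / q)) :=
      (hp.const_div_atTop _).add tendsto_const_nhds
    have hqa : 0 + 2 / q < a := by
      rw [zero_add, div_lt_iff₀ hq0]
      rw [div_lt_iff₀ hpos] at hq1
      linarith
    filter_upwards [hp.eventually hC, hlim.eventually (gt_mem_nhds hqa)] with n hn hlt
    refine lt_of_le_of_lt ?_ hlt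
    have hp0 := (h n).p_pos
    rw [div_le_iff₀ hp0]
    have : (C / pn n + 2 / q) * pn n = C + 2 * pn n / q := by
      field_simp
    rw [this]
    exact (hn _ _ _ _ (h n)).2

namespace LaneEmdenFamily

/-- The quantity `r u_p'(r)`, with the derivative taken within `[0, 1]`. -/
def flux (F : LaneEmdenFamily) (p r : ℝ) : ℝ :=
  r * derivWithin (F.u p) (Icc 0 1) r

variable (F : LaneEmdenFamily) {p : ℝ}

theorem continuousOn_flux (hp : 1 < p) : ContinuousOn (F.flux p) (Icc 0 1) :=
  continuousOn_id.mul <| (F.smooth p hp).continuousOn_derivWithin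
    (uniqueDiffOn_Icc zero_lt_one) (by norm_num)

theorem hasDerivAt_u (hp : 1 < p) {r : ℝ} (hr : r ∈ Ioo (0 : ℝ) 1) :
    HasDerivAt (F.u p) (F.flux p r / r) r := by
  have hmem : Icc (0 : ℝ) 1 ∈ nhds r := Icc_mem_nhds hr.1 hr.2
  have hd : DifferentiableAt ℝ (F.u p) r :=
    ((F.smooth p hp).contDiffAt hmem).differentiableAt (by norm_num)
  rw [flux, mul_div_cancel_left₀ _ hr.1.ne', derivWithin_of_mem_nhds hmem]
  exact hd.hasDerivAt

theorem hasDerivAt_flux (hp : 1 < p) {r : ℝ} (hr : r ∈ Ioo (0 : ℝ) 1) :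
    HasDerivAt (F.flux p) (-(r * (|F.u p r| ^ (p - 1) * F.u p r))) r := by
  have h2 : ContDiffOn ℝ 1 (deriv (F.u p)) (Ioo 0 1) :=
    ((F.smooth p hp).mono Ioo_subset_Icc_self).deriv_of_isOpen isOpen_Ioo (by norm_num)
  have hd : DifferentiableAt ℝ (deriv (F.u p)) r :=
    (h2.contDiffAt (Ioo_mem_nhds hr.1 hr.2)).differentiableAt (by norm_num)
  have h3 := (hasDerivAt_id r).mul hd.hasDerivAt
  have heq : F.flux p =ᶠ[nhds r] id * deriv (F.u p) := by
    filter_upwards [Ioo_mem_nhds hr.1 hr.2] with x hx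
    simp [flux, derivWithin_of_mem_nhds (Icc_mem_nhds hx.1 hx.2)]
  refine (h3.congr_of_eventuallyEq heq).congr_deriv ?_
  rw [← F.ode p hp r hr]
  have := hr.1.ne'
  simp only [id]
  field_simp
  ring

theorem laneEmdenProfile (hp : 1 < p) :
    LaneEmdenProfile p (p * (-F.u p 0) ^ (p - 1)) (F.rp p) (fun r => -F.u p r / -F.u p 0)
      (fun r => p * F.flux p r / -F.u p 0) := by
  have hm : 0 < -F.u p 0 := neg_pos.2 (F.center_neg p hp)
  have hp0 : 0 < p := by linarith
  obtain ⟨hR0, hR1⟩ := F.rp_mem p hp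
  have hsub : Icc 0 (F.rp p) ⊆ Icc 0 1 := Icc_subset_Icc le_rfl hR1.le
  have hcu := (F.smooth p hp).continuousOn.mono hsub
  have hcf := (F.continuousOn_flux hp).mono hsub
  refine ⟨hp0, by positivity, hR0, hcu.neg.div_const _, (hcf.const_smul p).div_const _,
    div_self hm.ne', by simp [F.rp_zero p hp], by simp [flux], fun r hr => ?_, fun r hr => ?_,
    fun r hr => ?_, fun r hr => ?_⟩
  · exact div_pos (neg_pos.2 (F.neg_in p hp r ⟨hr.1.le, hr.2⟩)) hm
  · rw [div_le_one hm]
    exact neg_le_neg (F.min_at_zero p hp r (hsub (Ioo_subset_Icc_self hr)))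
  · refine ((F.hasDerivAt_u hp ⟨hr.1, hr.2.trans hR1⟩).neg.div_const _).congr_deriv ?_
    have := hr.1.ne'
    have := hm.ne'
    field_simp
  · refine (((F.hasDerivAt_flux hp ⟨hr.1, hr.2.trans hR1⟩).const_mul p).div_const _).congr_deriv ?_
    have hu := F.neg_in p hp r ⟨hr.1.le, hr.2⟩
    have hu' : 0 < -F.u p r := neg_pos.2 hu
    have e : ∀ x : ℝ, 0 < x → x ^ p = x ^ (p - 1) * x := fun x hx => by
      rw [← rpow_add_one hx.ne']
      ring_nf
    rw [abs_of_neg hu, div_rpow hu'.le hm.le, e _ hu', e _ hm]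
    have := (rpow_pos_of_pos hm (p - 1)).ne'
    have := hm.ne'
    field_simp

theorem u_sp_pos (hp : 1 < p) : 0 < F.u p (F.sp p) :=
  F.pos_out p hp _ (F.sp_mem p hp)

theorem flux_mul_log_bounds (hp : 1 < p) :
    F.u p (F.sp p) ≤ F.flux p (F.rp p) * (log (F.sp p) - log (F.rp p)) ∧
      F.flux p (F.rp p) * (log (F.sp p) - log (F.rp p)) ≤ F.u p (F.sp p) +
        F.u p (F.sp p) ^ (p - 1) * F.u p (F.sp p) * F.sp p ^ 2 := by
  obtain ⟨hR0, -⟩ := F.rp_mem p hp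
  obtain ⟨hRs, hs1⟩ := F.sp_mem p hp
  have hU := F.u_sp_pos hp
  have hs0 := hR0.trans hRs
  set R := F.rp p
  set s := F.sp p
  set U := F.u p s
  have hsub : Icc R s ⊆ Icc 0 1 := Icc_subset_Icc hR0.le hs1.le
  have hcu := (F.smooth p hp).continuousOn.mono hsub
  have hcf := (F.continuousOn_flux hp).mono hsub
  have hclog : ContinuousOn (fun r => log s - log r) (Icc R s) :=
    continuousOn_const.sub (continuousOn_log.mono fun x hx => (hR0.trans_le hx.1).ne')
  have hcH : ContinuousOn (fun r => F.flux p r * (log s - log r) + F.u p r) (Icc R s) :=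
    (hcf.mul hclog).add hcu
  have hdH : ∀ r ∈ Ioo R s, HasDerivAt (fun r => F.flux p r * (log s - log r) + F.u p r)
      (-(r * (|F.u p r| ^ (p - 1) * F.u p r) * (log s - log r))) r := by
    intro r hr
    have hr0 := hR0.trans hr.1
    have hr' : r ∈ Ioo (0 : ℝ) 1 := ⟨hr0, hr.2.trans hs1⟩
    refine (((F.hasDerivAt_flux hp hr').mul ((hasDerivAt_log hr0.ne').const_sub (log s))).add
      (F.hasDerivAt_u hp hr')).congr_deriv ?_
    field_simp
    ring
  have hpos : ∀ r ∈ Ioo R s, 0 < F.u p r := fun r hr => F.pos_out p hp r ⟨hr.1, hr.2.trans hs1⟩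
  have hlog : ∀ r ∈ Ioo R s, 0 ≤ log s - log r := fun r hr =>
    sub_nonneg.2 (log_le_log (hR0.trans hr.1) hr.2.le)
  constructor
  · have := le_of_hasDerivAt_nonpos hRs.le hcH hdH fun r hr => by
      have := hpos r hr
      have := hlog r hr
      have := hR0.trans hr.1
      exact neg_nonpos.2 (by positivity)
    simpa [F.rp_zero p hp, R] using this
  · have := le_of_hasDerivAt_nonneg hRs.le
      (hcH.add (continuousOn_id.const_smul (U ^ (p - 1) * U * s)))
      (fun r hr => (hdH r hr).add ((hasDerivAt_id r).const_mul (U ^ (p - 1) * U * s)))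
      (fun r hr => by
        have hu := hpos r hr
        have hr0 := hR0.trans hr.1
        have h1 : F.u p r ≤ U := F.sp_max p hp r (hsub (Ioo_subset_Icc_self hr))
        have h2 : r * (log s - log r) ≤ s := by
          rw [← log_div hs0.ne' hr0.ne']
          have h3 := log_le_sub_one_of_pos (div_pos hs0 hr0)
          have h4 : r * log (s / r) ≤ r * (s / r - 1) := by gcongr
          have h5 : r * (s / r - 1) = s - r := by field_simp
          linarith
        have h6 : F.u p r ^ (p - 1) * F.u p r ≤ U ^ (p - 1) * U := by
          have : 0 ≤ p - 1 := by linarith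
          gcongr
        have h7 : (F.u p r ^ (p - 1) * F.u p r) * (r * (log s - log r))
            ≤ (U ^ (p - 1) * U) * s := by
          have := hlog r hr
          gcongr
        rw [abs_of_pos hu]
        linarith)
    simp only [Pi.add_apply, Pi.smul_apply, id, smul_eq_mul, sub_self, mul_zero, zero_add,
      R, F.rp_zero p hp, add_zero] at this
    have h8 : 0 ≤ U ^ (p - 1) * U * s * R := by positivity
    have h9 : U ^ (p - 1) * U * s * s = U ^ (p - 1) * U * s ^ 2 := by ring
    simp only [R, U, s] at *
    linarith

theorem sq_sp_div_epsP (hp : 1 < p) :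
    (F.sp p / epsP F p) ^ 2 = p * F.u p (F.sp p) ^ (p - 1) * F.sp p ^ 2 := by
  have hU := F.u_sp_pos hp
  have hp0 : 0 < p := by linarith
  rw [epsP, div_div_eq_mul_div, div_one, mul_pow, sq_sqrt (by positivity)]
  ring

end LaneEmdenFamily

theorem LaneEmdenFamily.tendsto_mul_flux (F : LaneEmdenFamily) {pn : ℕ → ℝ}
    (hpn : ∀ n, 1 < pn n) (hto : Tendsto pn atTop atTop) {rinf : ℝ} (hrinf : 0 < rinf)
    (hlimR : Tendsto (fun n => F.rp (pn n) ^ (2 / (pn n - 1))) atTop (nhds rinf)) :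
    Tendsto (fun n => pn n * F.flux (pn n) (F.rp (pn n))) atTop
      (nhds (4 * (exp (1 / 2) / rinf))) := by
  have hm : ∀ n, 0 < -F.u (pn n) 0 := fun n => neg_pos.2 (F.center_neg _ (hpn n))
  have hY := LaneEmdenProfile.tendsto_flux hto fun n => F.laneEmdenProfile (hpn n)
  have hΛ := LaneEmdenProfile.tendsto_log_div hto fun n => F.laneEmdenProfile (hpn n)
  have hlogR := hlimR.log hrinf.ne'
  have hlogp : Tendsto (fun n => log (pn n) / pn n) atTop (nhds 0) :=
    (isLittleO_log_id_atTop.tendsto_div_nhds_zero).comp hto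
  have h8 : Tendsto (fun n => log 8 / pn n) atTop (nhds 0) := hto.const_div_atTop _
  have hratio : Tendsto (fun n => pn n / (pn n - 1)) atTop (nhds 1) := by
    have h1 : Tendsto (fun n => 1 - 1 / pn n) atTop (nhds (1 - 0)) :=
      tendsto_const_nhds.sub (hto.const_div_atTop _)
    have h2 := h1.inv₀ (by norm_num)
    norm_num at h2
    refine h2.congr fun n => ?_
    have := hpn n
    have h3 : pn n - 1 ≠ 0 := by linarith
    have h4 : pn n ≠ 0 := by linarith
    field_simp
  have hlogm : Tendsto (fun n => log (-F.u (pn n) 0)) atTop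
      (nhds (1 * (1 / 2 - 0 + 0) - log rinf)) := by
    refine ((hratio.mul ((hΛ.sub hlogp).add h8)).sub hlogR).congr fun n => ?_
    have h1 := hpn n
    have h3 : pn n - 1 ≠ 0 := by linarith
    have h4 : 0 < pn n := by linarith
    have hR := (F.rp_mem _ (hpn n)).1
    have hmn := hm n
    rw [log_div (by positivity) (by norm_num), log_mul (by positivity) (by positivity),
      log_mul (by positivity) (by positivity), log_rpow hmn, log_rpow hR, log_pow]
    field_simp
    push_cast
    ring
  have hmlim : Tendsto (fun n => -F.u (pn n) 0) atTop (nhds (exp (1 / 2) / rinf)) := by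
    have h1 := hlogm.rexp
    rw [show 1 * (1 / 2 - 0 + 0) - log rinf = 1 / 2 - log rinf by ring, exp_sub,
      exp_log hrinf] at h1
    exact h1.congr fun n => exp_log (hm n)
  refine (hY.mul hmlim).congr fun n => ?_
  exact div_mul_cancel₀ _ (hm n).ne'

theorem LaneEmdenFamily.tendsto_log_sp_sub_log_rp (F : LaneEmdenFamily) {pn : ℕ → ℝ}
    (hpn : ∀ n, 1 < pn n) (hto : Tendsto pn atTop atTop) {l rinf uinf : ℝ}
    (hl : 0 < l) (hrinf : 0 < rinf) (huinf : 0 < uinf)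
    (hlimL : Tendsto (fun n => F.sp (pn n) / epsP F (pn n)) atTop (nhds l))
    (hlimR : Tendsto (fun n => F.rp (pn n) ^ (2 / (pn n - 1))) atTop (nhds rinf))
    (hlimU : Tendsto (fun n => F.u (pn n) (F.sp (pn n))) atTop (nhds uinf)) :
    Tendsto (fun n => (log (F.sp (pn n)) - log (F.rp (pn n))) / pn n) atTop
      (nhds (-(log rinf + log uinf) / 2)) := by
  have hlogR := hlimR.log hrinf.ne'
  have hlogU := hlimU.log huinf.ne'
  have hlogL := ((hlimL.pow 2).log (pow_pos hl 2).ne').div_atTop hto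
  have hlogp : Tendsto (fun n => log (pn n) / pn n) atTop (nhds 0) :=
    (isLittleO_log_id_atTop.tendsto_div_nhds_zero).comp hto
  have hratio : Tendsto (fun n => 1 - 1 / pn n) atTop (nhds (1 - 0)) :=
    tendsto_const_nhds.sub (hto.const_div_atTop _)
  have key := ((hlogL.sub hlogp).sub (hratio.mul (hlogR.add hlogU))).div_const 2
  rw [show (0 - 0 - (1 - 0) * (log rinf + log uinf)) / 2 = -(log rinf + log uinf) / 2 by ring]
    at key
  refine key.congr fun n => ?_
  have h1 := hpn n
  have h3 : pn n - 1 ≠ 0 := by linarith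
  have h4 : 0 < pn n := by linarith
  have hR := (F.rp_mem _ (hpn n)).1
  have hs := hR.trans (F.sp_mem _ (hpn n)).1
  have hU := F.u_sp_pos (hpn n)
  rw [F.sq_sp_div_epsP (hpn n), log_mul (by positivity) (by positivity),
    log_mul (by positivity) (by positivity), log_rpow hU, log_rpow hR, log_pow]
  field_simp
  push_cast
  ring

theorem LaneEmdenFamily.tendsto_flux_mul_log (F : LaneEmdenFamily) {pn : ℕ → ℝ}
    (hpn : ∀ n, 1 < pn n) (hto : Tendsto pn atTop atTop) {l : ℝ}
    (hlimL : Tendsto (fun n => F.sp (pn n) / epsP F (pn n)) atTop (nhds l)) :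
    Tendsto (fun n => F.flux (pn n) (F.rp (pn n)) * (log (F.sp (pn n)) - log (F.rp (pn n)))
      / F.u (pn n) (F.sp (pn n))) atTop (nhds 1) := by
  have hup : Tendsto (fun n => 1 + (F.sp (pn n) / epsP F (pn n)) ^ 2 / pn n) atTop
      (nhds (1 + 0)) := tendsto_const_nhds.add ((hlimL.pow 2).div_atTop hto)
  rw [add_zero] at hup
  refine tendsto_of_tendsto_of_tendsto_of_le_of_le tendsto_const_nhds hup (fun n => ?_)
    (fun n => ?_)
  · have hU := F.u_sp_pos (hpn n)
    simpa [le_div_iff₀ hU] using (F.flux_mul_log_bounds (hpn n)).1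
  · have hU := F.u_sp_pos (hpn n)
    have h4 : pn n ≠ 0 := by linarith [hpn n]
    have := (F.flux_mul_log_bounds (hpn n)).2
    simp only [F.sq_sp_div_epsP (hpn n)]
    rw [div_le_iff₀ hU]
    refine this.trans (le_of_eq ?_)
    field_simp

theorem strictMonoOn_const_mul_log_add {c : ℝ} (hc : 0 < c) :
    StrictMonoOn (fun t : ℝ => c * log t + t) (Ioi 0) := fun x hx y _ hxy => by
  have := log_lt_log hx hxy
  simp only
  gcongr

/-- The equation `2√e·log x + x = 0` has a unique positive root `t̄`, and under the stated limit assumptions `r_∞·u_∞` equals this root; consequently `r_∞ = t̄/u_∞`. -/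
theorem rinf_uinf_is_root (F : LaneEmdenFamily) (pn : ℕ → ℝ) (hpn : ∀ n, 1 < pn n)
    (hto : Tendsto pn atTop atTop) (l rinf uinf : ℝ)
    (hl : 0 < l) (hrinf : 0 < rinf) (hrinf1 : rinf ≤ 1) (huinf : 0 < uinf)
    (hlimL : Tendsto (fun n => F.sp (pn n) / epsP F (pn n)) atTop (nhds l))
    (hlimR : Tendsto (fun n => F.rp (pn n) ^ (2 / (pn n - 1))) atTop (nhds rinf))
    (hlimU : Tendsto (fun n => F.u (pn n) (F.sp (pn n))) atTop (nhds uinf)) :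
    (∃! t : ℝ, 0 < t ∧ 2 * Real.sqrt (Real.exp 1) * Real.log t + t = 0) ∧
    (2 * Real.sqrt (Real.exp 1) * Real.log (rinf * uinf) + rinf * uinf = 0) ∧
    ∀ t : ℝ, 0 < t → 2 * Real.sqrt (Real.exp 1) * Real.log t + t = 0 → rinf = t / uinf := by
  have hroot : 2 * √(exp 1) * log (rinf * uinf) + rinf * uinf = 0 := by
    have h1 := ((F.tendsto_mul_flux hpn hto hrinf hlimR).mul (F.tendsto_log_sp_sub_log_rp hpn hto hl
      hrinf huinf hlimL hlimR hlimU)).div hlimU huinf.ne'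
    have h2 := tendsto_nhds_unique (F.tendsto_flux_mul_log hpn hto hlimL) (h1.congr fun n => by
      have : pn n ≠ 0 := by linarith [hpn n]
      simp only [Pi.div_apply]
      field_simp)
    rw [log_mul hrinf.ne' huinf.ne', ← exp_half]
    field_simp at h2
    linarith
  have hinj := (strictMonoOn_const_mul_log_add (c := 2 * √(exp 1)) (by positivity)).injOn
  have huniq : ∀ t : ℝ, 0 < t → 2 * √(exp 1) * log t + t = 0 → t = rinf * uinf :=
    fun t ht h => hinj ht (mul_pos hrinf huinf) (h.trans hroot.symm)
  refine ⟨⟨rinf * uinf, ⟨mul_pos hrinf huinf, hroot⟩, fun t ht => huniq t ht.1 ht.2⟩, hroot,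
    fun t ht h => ?_⟩
  rw [huniq t ht h, mul_div_cancel_right₀ _ huinf.ne']
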